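/- Let G be a 2-player stage game and G(T) the T-round repeated game in which player 1 may use mixed strategies and player 2 may only use pure strategies. For any subgame-perfect equilibrium μ of G(T) in which, for every round and every reachable history, the round strategy profile forms a stage-game Nash equilibrium (an element of Nash^{m,p}(G)), player 1's total expected payoff in the repeated game satisfies U₁(μ) = Σ_{k=1}^{T} c_k for some c₁, …, c_T ∈ V₁^{m,p}; i.e., player 1's total payoff equals the sum of some sequence of T stage-game Nash equilibrium payoffs. -/

import Mathlib

open Finset

/-- A mixed strategy on a finite action set: a probability distribution. -/
structure Mix (A : Type*) [Fintype A] where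
  p : A → ℝ
  nonneg : ∀ a, 0 ≤ p a
  sum_one : ∑ a, p a = 1

namespace Mix

/-- The Dirac (pure) mixed strategy at an action. -/
def pure {A : Type*} [Fintype A] [DecidableEq A] (a : A) : Mix A where
  p := fun b => if b = a then 1 else 0
  nonneg := by intro b; by_cases hb : b = a <;> simp [hb]
  sum_one := by simp

/-- The support of a mixed strategy. -/
def support {A : Type*} [Fintype A] (σ : Mix A) : Set A := {a | 0 < σ.p a}

end Mix

section TwoPlayer

variable {A₁ A₂ : Type*} [Fintype A₁] [Fintype A₂] [DecidableEq A₁] [DecidableEq A₂]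

/-- Expected payoff under a mixed strategy profile. -/
def expPay (u : A₁ → A₂ → ℝ) (σ₁ : Mix A₁) (σ₂ : Mix A₂) : ℝ :=
  ∑ a₁, ∑ a₂, σ₁.p a₁ * σ₂.p a₂ * u a₁ a₂

/-- Player 1's pure action `a₁` is a best response among pure strategies to `a₂`. -/
def BR1p (u₁ : A₁ → A₂ → ℝ) (a₁ : A₁) (a₂ : A₂) : Prop := ∀ b₁, u₁ b₁ a₂ ≤ u₁ a₁ a₂

/-- Player 2's pure action `a₂` is a best response among pure strategies to `a₁`. -/
def BR2p (u₂ : A₁ → A₂ → ℝ) (a₁ : A₁) (a₂ : A₂) : Prop := ∀ b₂, u₂ a₁ b₂ ≤ u₂ a₁ a₂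

/-- Player 1's mixed strategy `σ₁` is a best response (among mixed strategies) to `σ₂`. -/
def BR1m (u₁ : A₁ → A₂ → ℝ) (σ₁ : Mix A₁) (σ₂ : Mix A₂) : Prop :=
  ∀ τ₁ : Mix A₁, expPay u₁ τ₁ σ₂ ≤ expPay u₁ σ₁ σ₂

/-- Player 2's mixed strategy `σ₂` is a best response (among mixed strategies) to `σ₁`. -/
def BR2m (u₂ : A₁ → A₂ → ℝ) (σ₁ : Mix A₁) (σ₂ : Mix A₂) : Prop :=
  ∀ τ₂ : Mix A₂, expPay u₂ σ₁ τ₂ ≤ expPay u₂ σ₁ σ₂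

/-- Player 2's pure action `a₂` is a best response among pure strategies to mixed `σ₁`. -/
def BR2pm (u₂ : A₁ → A₂ → ℝ) (σ₁ : Mix A₁) (a₂ : A₂) : Prop :=
  ∀ b₂ : A₂, expPay u₂ σ₁ (Mix.pure b₂) ≤ expPay u₂ σ₁ (Mix.pure a₂)

/-- Pure Nash equilibria (both players restricted to pure strategies). -/
def NashPP (u₁ u₂ : A₁ → A₂ → ℝ) : Set (A₁ × A₂) :=
  {q | BR1p u₁ q.1 q.2 ∧ BR2p u₂ q.1 q.2}

/-- Nash equilibria when player 1 is mixed and player 2 is pure. -/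
def NashMP (u₁ u₂ : A₁ → A₂ → ℝ) : Set (Mix A₁ × A₂) :=
  {q | BR1m u₁ q.1 (Mix.pure q.2) ∧ BR2pm u₂ q.1 q.2}

/-- Mixed Nash equilibria. -/
def NashMM (u₁ u₂ : A₁ → A₂ → ℝ) : Set (Mix A₁ × Mix A₂) :=
  {q | BR1m u₁ q.1 q.2 ∧ BR2m u₂ q.1 q.2}

def V1pp (u₁ u₂ : A₁ → A₂ → ℝ) : Set ℝ := (fun q => u₁ q.1 q.2) '' NashPP u₁ u₂
def V2pp (u₁ u₂ : A₁ → A₂ → ℝ) : Set ℝ := (fun q => u₂ q.1 q.2) '' NashPP u₁ u₂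
def V1mp (u₁ u₂ : A₁ → A₂ → ℝ) : Set ℝ :=
  (fun q => expPay u₁ q.1 (Mix.pure q.2)) '' NashMP u₁ u₂
def V2mp (u₁ u₂ : A₁ → A₂ → ℝ) : Set ℝ :=
  (fun q => expPay u₂ q.1 (Mix.pure q.2)) '' NashMP u₁ u₂
def V1mm (u₁ u₂ : A₁ → A₂ → ℝ) : Set ℝ := (fun q => expPay u₁ q.1 q.2) '' NashMM u₁ u₂
def V2mm (u₁ u₂ : A₁ → A₂ → ℝ) : Set ℝ := (fun q => expPay u₂ q.1 q.2) '' NashMM u₁ u₂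

/-- The set `V` is a singleton, i.e. `|V| = 1`. -/
def oneVal (V : Set ℝ) : Prop := ∃ v, V = {v}

/-- A history of play: a finite sequence of pure action profiles. -/
abbrev Hist (A₁ A₂ : Type*) := List (A₁ × A₂)

/-- A pure behavior strategy for player 1, seen as a mixed behavior strategy. -/
def pureBeh1 (μ : Hist A₁ A₂ → A₁) : Hist A₁ A₂ → Mix A₁ := fun h => Mix.pure (μ h)

/-- A pure behavior strategy for player 2, seen as a mixed behavior strategy. -/
def pureBeh2 (μ : Hist A₁ A₂ → A₂) : Hist A₁ A₂ → Mix A₂ := fun h => Mix.pure (μ h)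

/-- Expected total payoff (w.r.t. `u`) over `T` remaining rounds, after history `h`. -/
def totPay (u : A₁ → A₂ → ℝ) (μ₁ : Hist A₁ A₂ → Mix A₁) (μ₂ : Hist A₁ A₂ → Mix A₂) :
    ℕ → Hist A₁ A₂ → ℝ
  | 0, _ => 0
  | T + 1, h =>
      ∑ a₁, ∑ a₂, (μ₁ h).p a₁ * (μ₂ h).p a₂ * (u a₁ a₂ + totPay u μ₁ μ₂ T (h ++ [(a₁, a₂)]))

/-- The behavior strategy induced on the subgame following history `h`. -/
def condS {A₁ A₂ α : Type*} (μ : Hist A₁ A₂ → α) (h : Hist A₁ A₂) : Hist A₁ A₂ → α :=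
  fun h' => μ (h ++ h')

/-- Nash equilibrium of the `T`-round repeated game, both players mixed. -/
def isNEmm (u₁ u₂ : A₁ → A₂ → ℝ) (T : ℕ)
    (μ₁ : Hist A₁ A₂ → Mix A₁) (μ₂ : Hist A₁ A₂ → Mix A₂) : Prop :=
  (∀ μ₁' : Hist A₁ A₂ → Mix A₁, totPay u₁ μ₁' μ₂ T [] ≤ totPay u₁ μ₁ μ₂ T []) ∧
  (∀ μ₂' : Hist A₁ A₂ → Mix A₂, totPay u₂ μ₁ μ₂' T [] ≤ totPay u₂ μ₁ μ₂ T [])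

/-- Subgame-perfect equilibrium of the `T`-round repeated game, both players mixed. -/
def isSPEmm (u₁ u₂ : A₁ → A₂ → ℝ) (T : ℕ)
    (μ₁ : Hist A₁ A₂ → Mix A₁) (μ₂ : Hist A₁ A₂ → Mix A₂) : Prop :=
  ∀ h : Hist A₁ A₂, h.length < T → isNEmm u₁ u₂ (T - h.length) (condS μ₁ h) (condS μ₂ h)

/-- Nash equilibrium of the `T`-round repeated game, player 1 mixed and player 2 pure. -/
def isNEmp (u₁ u₂ : A₁ → A₂ → ℝ) (T : ℕ)
    (μ₁ : Hist A₁ A₂ → Mix A₁) (μ₂ : Hist A₁ A₂ → A₂) : Prop :=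
  (∀ μ₁' : Hist A₁ A₂ → Mix A₁,
      totPay u₁ μ₁' (pureBeh2 μ₂) T [] ≤ totPay u₁ μ₁ (pureBeh2 μ₂) T []) ∧
  (∀ μ₂' : Hist A₁ A₂ → A₂,
      totPay u₂ μ₁ (pureBeh2 μ₂') T [] ≤ totPay u₂ μ₁ (pureBeh2 μ₂) T [])

/-- SPE of the `T`-round repeated game, player 1 mixed and player 2 pure. -/
def isSPEmp (u₁ u₂ : A₁ → A₂ → ℝ) (T : ℕ)
    (μ₁ : Hist A₁ A₂ → Mix A₁) (μ₂ : Hist A₁ A₂ → A₂) : Prop :=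
  ∀ h : Hist A₁ A₂, h.length < T → isNEmp u₁ u₂ (T - h.length) (condS μ₁ h) (condS μ₂ h)

/-- Nash equilibrium of the `T`-round repeated game, both players pure. -/
def isNEpp (u₁ u₂ : A₁ → A₂ → ℝ) (T : ℕ)
    (μ₁ : Hist A₁ A₂ → A₁) (μ₂ : Hist A₁ A₂ → A₂) : Prop :=
  (∀ μ₁' : Hist A₁ A₂ → A₁,
      totPay u₁ (pureBeh1 μ₁') (pureBeh2 μ₂) T [] ≤
        totPay u₁ (pureBeh1 μ₁) (pureBeh2 μ₂) T []) ∧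
  (∀ μ₂' : Hist A₁ A₂ → A₂,
      totPay u₂ (pureBeh1 μ₁) (pureBeh2 μ₂') T [] ≤
        totPay u₂ (pureBeh1 μ₁) (pureBeh2 μ₂) T [])

/-- SPE of the `T`-round repeated game, both players pure. -/
def isSPEpp (u₁ u₂ : A₁ → A₂ → ℝ) (T : ℕ)
    (μ₁ : Hist A₁ A₂ → A₁) (μ₂ : Hist A₁ A₂ → A₂) : Prop :=
  ∀ h : Hist A₁ A₂, h.length < T → isNEpp u₁ u₂ (T - h.length) (condS μ₁ h) (condS μ₂ h)

/-- `G ∈ 𝒢_LS^{p,p}`: local suboptimality occurs in some SPE of some `G(T)`,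
both players restricted to pure strategies. -/
def GLSpp (u₁ u₂ : A₁ → A₂ → ℝ) : Prop :=
  ∃ T : ℕ, 1 ≤ T ∧ ∃ (μ₁ : Hist A₁ A₂ → A₁) (μ₂ : Hist A₁ A₂ → A₂),
    isSPEpp u₁ u₂ T μ₁ μ₂ ∧ ∃ h : Hist A₁ A₂, h.length < T ∧ (μ₁ h, μ₂ h) ∉ NashPP u₁ u₂

/-- `G ∈ 𝒢_LS^{m,p}`: local suboptimality occurs in some SPE of some `G(T)`,
player 1 mixed and player 2 pure. -/
def GLSmp (u₁ u₂ : A₁ → A₂ → ℝ) : Prop :=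
  ∃ T : ℕ, 1 ≤ T ∧ ∃ (μ₁ : Hist A₁ A₂ → Mix A₁) (μ₂ : Hist A₁ A₂ → A₂),
    isSPEmp u₁ u₂ T μ₁ μ₂ ∧ ∃ h : Hist A₁ A₂, h.length < T ∧ (μ₁ h, μ₂ h) ∉ NashMP u₁ u₂

/-- `G ∈ 𝒢_LS^{m,m}`: local suboptimality occurs in some SPE of some `G(T)`,
both players mixed. -/
def GLSmm (u₁ u₂ : A₁ → A₂ → ℝ) : Prop :=
  ∃ T : ℕ, 1 ≤ T ∧ ∃ (μ₁ : Hist A₁ A₂ → Mix A₁) (μ₂ : Hist A₁ A₂ → Mix A₂),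
    isSPEmm u₁ u₂ T μ₁ μ₂ ∧ ∃ h : Hist A₁ A₂, h.length < T ∧ (μ₁ h, μ₂ h) ∉ NashMM u₁ u₂

/-- The pure-pure characterization condition (condition of the pure-strategy theorem). -/
def condPP (u₁ u₂ : A₁ → A₂ → ℝ) : Prop :=
  ((V1pp u₁ u₂).Nontrivial ∧ (V2pp u₁ u₂).Nontrivial ∧
    ∃ (a₁ : A₁) (a₂ : A₂), (a₁, a₂) ∉ NashPP u₁ u₂) ∨
  ((V1pp u₁ u₂).Nontrivial ∧ oneVal (V2pp u₁ u₂) ∧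
    ∃ (a₁ a₁' : A₁) (a₂ : A₂), u₁ a₁ a₂ < u₁ a₁' a₂ ∧ BR2p u₂ a₁ a₂) ∨
  (oneVal (V1pp u₁ u₂) ∧ (V2pp u₁ u₂).Nontrivial ∧
    ∃ (a₁ : A₁) (a₂ a₂' : A₂), u₂ a₁ a₂ < u₂ a₁ a₂' ∧ BR1p u₁ a₁ a₂)

/-- The mixed-mixed characterization condition (condition of the general-case theorem). -/
def condMM (u₁ u₂ : A₁ → A₂ → ℝ) : Prop :=
  ((V1mm u₁ u₂).Nontrivial ∧ (V2mm u₁ u₂).Nontrivial ∧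
    ∃ (σ₁ : Mix A₁) (σ₂ : Mix A₂), (σ₁, σ₂) ∉ NashMM u₁ u₂) ∨
  ((V1mm u₁ u₂).Nontrivial ∧ oneVal (V2mm u₁ u₂) ∧
    ∃ (σ₁ : Mix A₁) (σ₂ : Mix A₂) (a₁' : A₁),
      expPay u₁ σ₁ σ₂ < expPay u₁ (Mix.pure a₁') σ₂ ∧ BR2m u₂ σ₁ σ₂) ∨
  (oneVal (V1mm u₁ u₂) ∧ (V2mm u₁ u₂).Nontrivial ∧
    ∃ (σ₁ : Mix A₁) (σ₂ : Mix A₂) (a₂' : A₂),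
      expPay u₂ σ₁ σ₂ < expPay u₂ σ₁ (Mix.pure a₂') ∧ BR1m u₁ σ₁ σ₂)

/-- The set `D` of differences of player 1's payoffs between pairs of stage-game
Nash equilibria (mixed-pure case). -/
def Dmp (u₁ u₂ : A₁ → A₂ → ℝ) : Set ℝ :=
  {x | ∃ q ∈ NashMP u₁ u₂, ∃ q' ∈ NashMP u₁ u₂,
    x = expPay u₁ q.1 (Mix.pure q.2) - expPay u₁ q'.1 (Mix.pure q'.2)}

/-- `x` is a finite (possibly empty) sum of elements of `D`. -/
def sumOfD (D : Set ℝ) (x : ℝ) : Prop :=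
  ∃ (n : ℕ) (d : Fin n → ℝ), (∀ k, d k ∈ D) ∧ x = ∑ k, d k

/-- The mixed-pure characterization condition (condition of the
pure-strategy-against-mixed-strategy theorem). -/
def condMP (u₁ u₂ : A₁ → A₂ → ℝ) : Prop :=
  ((V1mp u₁ u₂).Nontrivial ∧ (V2mp u₁ u₂).Nontrivial ∧
    ∃ (σ₁ : Mix A₁) (a₂ : A₂), (σ₁, a₂) ∉ NashMP u₁ u₂) ∨
  ((V1mp u₁ u₂).Nontrivial ∧ oneVal (V2mp u₁ u₂) ∧
    ∃ (σ₁ : Mix A₁) (a₁' : A₁) (a₂ : A₂),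
      expPay u₁ σ₁ (Mix.pure a₂) < u₁ a₁' a₂ ∧
      BR2pm u₂ σ₁ a₂ ∧
      (σ₁.support.Nontrivial →
        ∃ a ∈ σ₁.support, ∀ a' ∈ σ₁.support, a' ≠ a →
          sumOfD (Dmp u₁ u₂) (u₁ a a₂ - u₁ a' a₂))) ∨
  (oneVal (V1mp u₁ u₂) ∧ (V2mp u₁ u₂).Nontrivial ∧
    ∃ (σ₁ : Mix A₁) (a₂ a₂' : A₂),
      expPay u₂ σ₁ (Mix.pure a₂) < expPay u₂ σ₁ (Mix.pure a₂') ∧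
      BR1m u₁ σ₁ (Mix.pure a₂))

/-- A history is reachable under the behavior profile `(μ₁, μ₂)` (mixed-pure case):
every action of player 1 along it has positive probability and every action of
player 2 along it is the prescribed one. -/
def reachableMP (μ₁ : Hist A₁ A₂ → Mix A₁) (μ₂ : Hist A₁ A₂ → A₂) (h : Hist A₁ A₂) : Prop :=
  ∀ k : Fin h.length, 0 < (μ₁ (h.take k.val)).p (h.get k).1 ∧ μ₂ (h.take k.val) = (h.get k).2

end TwoPlayer

namespace Mix

/-- If no value of `f` exceeds its mean under `σ`, every value on the support equals the mean. -/
theorem eq_sum_of_forall_le {A : Type*} [Fintype A] (σ : Mix A) (f : A → ℝ)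
    (hf : ∀ b, f b ≤ ∑ a, σ.p a * f a) {a : A} (ha : 0 < σ.p a) :
    f a = ∑ b, σ.p b * f b := by
  set m := ∑ b, σ.p b * f b with hm
  have hsum : ∑ b, σ.p b * (m - f b) = 0 := by
    simp only [mul_sub, sum_sub_distrib, ← sum_mul, σ.sum_one, ← hm]
    ring
  have h0 := (sum_eq_zero_iff_of_nonneg fun b _ =>
    mul_nonneg (σ.nonneg b) (sub_nonneg.2 (hf b))).1 hsum a (mem_univ a)
  rcases mul_eq_zero.1 h0 with h | h <;> linarith

theorem exists_pos {A : Type*} [Fintype A] (σ : Mix A) : ∃ a, 0 < σ.p a := by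
  by_contra! h
  have h1 := σ.sum_one
  have h2 : ∑ a, σ.p a ≤ 0 := sum_nonpos fun a _ => h a
  linarith

end Mix

theorem reachableMP.append {A₁ A₂ : Type*} [Fintype A₁] {μ₁ : Hist A₁ A₂ → Mix A₁}
    {μ₂ : Hist A₁ A₂ → A₂} {h : Hist A₁ A₂} (hr : reachableMP μ₁ μ₂ h)
    {a : A₁} (ha : 0 < (μ₁ h).p a) :
    reachableMP μ₁ μ₂ (h ++ [(a, μ₂ h)]) := by
  rintro ⟨k, hk⟩
  have hk' : k ≤ h.length := by simpa [Nat.lt_succ_iff] using hk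
  rcases hk'.lt_or_eq with hlt | rfl
  · simpa [List.take_append_of_le_length hk', List.getElem_append_left hlt] using hr ⟨k, hlt⟩
  · simpa using ha

section TwoPlayer
variable {A₁ A₂ : Type*} [Fintype A₁] [Fintype A₂]

theorem totPay_condS (u : A₁ → A₂ → ℝ) (μ₁ : Hist A₁ A₂ → Mix A₁) (μ₂ : Hist A₁ A₂ → Mix A₂)
    (h : Hist A₁ A₂) (n : ℕ) (h' : Hist A₁ A₂) :
    totPay u (condS μ₁ h) (condS μ₂ h) n h' = totPay u μ₁ μ₂ n (h ++ h') := by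
  induction n generalizing h' with
  | zero => rfl
  | succ n ih => simp only [totPay, ih, condS, List.append_assoc]

variable [DecidableEq A₂]

theorem expPay_pure_right (u : A₁ → A₂ → ℝ) (σ : Mix A₁) (b : A₂) :
    expPay u σ (Mix.pure b) = ∑ a, σ.p a * u a b := by
  simp [expPay, Mix.pure]

theorem totPay_succ_pureBeh2 (u : A₁ → A₂ → ℝ) (μ₁ : Hist A₁ A₂ → Mix A₁)
    (μ₂ : Hist A₁ A₂ → A₂) (n : ℕ) (h : Hist A₁ A₂) :
    totPay u μ₁ (pureBeh2 μ₂) (n + 1) h =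
      ∑ a, (μ₁ h).p a * (u a (μ₂ h) + totPay u μ₁ (pureBeh2 μ₂) n (h ++ [(a, μ₂ h)])) := by
  simp [totPay, pureBeh2, Mix.pure]

variable [DecidableEq A₁]

/-- Changing a strategy at the empty history does not affect later continuation payoffs. -/
theorem totPay_update_nil (u : A₁ → A₂ → ℝ) (μ₁ : Hist A₁ A₂ → Mix A₁)
    (μ₂ : Hist A₁ A₂ → Mix A₂) (σ : Mix A₁) (n : ℕ) {h : Hist A₁ A₂} (hh : h ≠ []) :
    totPay u (Function.update μ₁ [] σ) μ₂ n h = totPay u μ₁ μ₂ n h := by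
  induction n generalizing h with
  | zero => rfl
  | succ n ih =>
    simp only [totPay, Function.update_of_ne hh]
    refine sum_congr rfl fun a _ => sum_congr rfl fun b _ => ?_
    rw [ih (by simp)]

/-- In a Nash equilibrium of the repeated game, a one-shot deviation of player 1 in the first
round is not profitable. -/
theorem isNEmp.le_totPay {u₁ u₂ : A₁ → A₂ → ℝ} {n : ℕ} {μ₁ : Hist A₁ A₂ → Mix A₁}
    {μ₂ : Hist A₁ A₂ → A₂} (hNE : isNEmp u₁ u₂ (n + 1) μ₁ μ₂) (b : A₁) :
    u₁ b (μ₂ []) + totPay u₁ μ₁ (pureBeh2 μ₂) n [(b, μ₂ [])] ≤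
      totPay u₁ μ₁ (pureBeh2 μ₂) (n + 1) [] := by
  refine le_of_eq_of_le ?_ (hNE.1 (Function.update μ₁ [] (Mix.pure b)))
  rw [totPay_succ_pureBeh2]
  simp [Mix.pure, totPay_update_nil]

/-- Along reachable histories, the continuation payoff of player 1 is a sum of stage-game
equilibrium payoffs. -/
theorem exists_totPay_eq_sum_of_reachableMP {u₁ u₂ : A₁ → A₂ → ℝ} {T : ℕ}
    {μ₁ : Hist A₁ A₂ → Mix A₁} {μ₂ : Hist A₁ A₂ → A₂}
    (hSPE : isSPEmp u₁ u₂ T μ₁ μ₂)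
    (hNash : ∀ h : Hist A₁ A₂, h.length < T → reachableMP μ₁ μ₂ h →
      (μ₁ h, μ₂ h) ∈ NashMP u₁ u₂)
    (n : ℕ) (h : Hist A₁ A₂) (hlen : h.length + n = T) (hr : reachableMP μ₁ μ₂ h) :
    ∃ c : Fin n → ℝ, (∀ k, c k ∈ V1mp u₁ u₂) ∧
      totPay u₁ μ₁ (pureBeh2 μ₂) n h = ∑ k, c k := by
  induction n generalizing h with
  | zero => exact ⟨Fin.elim0, fun k => k.elim0, by simp [totPay]⟩
  | succ n ih =>
    have hlt : h.length < T := by omega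
    obtain ⟨a, ha⟩ := (μ₁ h).exists_pos
    have hN := hNash h hlt hr
    have hstage : u₁ a (μ₂ h) = expPay u₁ (μ₁ h) (Mix.pure (μ₂ h)) := by
      rw [expPay_pure_right]
      refine (μ₁ h).eq_sum_of_forall_le (fun b => u₁ b (μ₂ h)) (fun b => ?_) ha
      have hb := hN.1 (Mix.pure b)
      simp only [expPay_pure_right] at hb
      simpa [Mix.pure] using hb
    have hcont : u₁ a (μ₂ h) + totPay u₁ μ₁ (pureBeh2 μ₂) n (h ++ [(a, μ₂ h)]) =
        totPay u₁ μ₁ (pureBeh2 μ₂) (n + 1) h := by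
      rw [totPay_succ_pureBeh2]
      refine (μ₁ h).eq_sum_of_forall_le
        (fun b => u₁ b (μ₂ h) + totPay u₁ μ₁ (pureBeh2 μ₂) n (h ++ [(b, μ₂ h)])) (fun b => ?_) ha
      have hNE := hSPE h hlt
      rw [show T - h.length = n + 1 by omega] at hNE
      have hb := hNE.le_totPay b
      rw [show pureBeh2 (condS μ₂ h) = condS (pureBeh2 μ₂) h from rfl, totPay_condS,
        totPay_condS] at hb
      simpa [condS, totPay_succ_pureBeh2] using hb
    obtain ⟨c, hc, hsum⟩ := ih (h ++ [(a, μ₂ h)]) (by simp; omega) (hr.append ha)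
    refine ⟨Fin.cons (u₁ a (μ₂ h)) c, fun k => ?_, ?_⟩
    · cases k using Fin.cases with
      | zero => exact ⟨_, hN, hstage.symm⟩
      | succ k => exact hc k
    · rw [← hcont, hsum, Fin.sum_univ_succ]
      simp

end TwoPlayer

section TwoPlayer
variable {A₁ A₂ : Type*} [Fintype A₁] [Fintype A₂] [DecidableEq A₁] [DecidableEq A₂]
variable [Nonempty A₁] [Nonempty A₂]

/-- Lemma: in any SPE of the repeated game (player 1 mixed, player 2 pure) in which
the round strategy profile at every reachable history is a stage-game Nash equilibrium,
player 1's total payoff is a sum of `T` stage-game Nash equilibrium payoffs. -/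
theorem spe_payoff_sum_of_nash_values (u₁ u₂ : A₁ → A₂ → ℝ) (T : ℕ)
    (μ₁ : Hist A₁ A₂ → Mix A₁) (μ₂ : Hist A₁ A₂ → A₂)
    (hSPE : isSPEmp u₁ u₂ T μ₁ μ₂)
    (hNash : ∀ h : Hist A₁ A₂, h.length < T → reachableMP μ₁ μ₂ h →
      (μ₁ h, μ₂ h) ∈ NashMP u₁ u₂) :
    ∃ c : Fin T → ℝ, (∀ k, c k ∈ V1mp u₁ u₂) ∧
      totPay u₁ μ₁ (pureBeh2 μ₂) T [] = ∑ k, c k :=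
  exists_totPay_eq_sum_of_reachableMP hSPE hNash T [] (by simp) fun k => k.elim0

end TwoPlayer
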